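/- arXiv:1409.3517 — 2 statements merged into one kernel-verified Lean document; each statement's English description precedes it below -/
import Mathlib

section
/- Let g be a finite-dimensional semisimple Lie algebra over ℂ with Killing form κ, θ an automorphism of g with θ^m = id, ξ_m = exp(2πi/m), g_i the ξ_m^i-eigenspace of θ. Let L := ℂ[u,u⁻¹] ⊗_ℂ g, g(θ,m) := ⊕_{i∈ℤ} u^i ⊗ g_{i mod m}, ⟨u^i⊗x, u^j⊗y⟩ = δ_{i,-j}·κ(x,y), and let δ : L → L be the derivation with δ(u^i⊗x) = i·u^i⊗x. Let X ∈ g_1 be regular semisimple, p := u⊗X, a := {ξ ∈ g(θ,m) : ⁅p, ξ⁆ = 0}, and a_i := a ∩ (u^i ⊗ g_{i mod m}). Define c(v,w) := ⟨δ(v), w⟩. Then for every n ≠ 0 and every nonzero z ∈ a_n there exists z' ∈ a_{-n} with c(z, z') ≠ 0; in particular c does not vanish identically on a × a, so (a being abelian, hence all its 2-coboundaries with trivial coefficients vanishing) the central extension of a defined by the 2-cocycle c is non-split. -/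
open TensorProduct LaurentPolynomial

/-- The loop algebra `ℂ[T,T⁻¹] ⊗ g` is a complex Lie algebra. -/
noncomputable instance loopLieAlgebra (g : Type*) [LieRing g] [LieAlgebra ℂ g] :
    LieAlgebra ℂ (LaurentPolynomial ℂ ⊗[ℂ] g) :=
  { (inferInstance : Module ℂ (LaurentPolynomial ℂ ⊗[ℂ] g)) with
    lie_smul := fun c x y => by
      rw [← algebraMap_smul (LaurentPolynomial ℂ) c y,
        lie_smul ((algebraMap ℂ (LaurentPolynomial ℂ)) c) x y,
        algebraMap_smul] }

/-- The centralizer of an element `X` of a Lie algebra, as a Lie subalgebra. -/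
def centralizerSubalgebra (K : Type*) (g : Type*) [CommRing K] [LieRing g]
    [LieAlgebra K g] (X : g) : LieSubalgebra K g where
  carrier := {y | ⁅X, y⁆ = 0}
  add_mem' := by
    intro a b ha hb
    simp only [Set.mem_setOf_eq, lie_add] at *
    rw [ha, hb, add_zero]
  zero_mem' := by simp
  smul_mem' := by
    intro c a ha
    simp only [Set.mem_setOf_eq, lie_smul] at *
    rw [ha, smul_zero]
  lie_mem' := by
    intro a b ha hb
    simp only [Set.mem_setOf_eq] at *
    rw [leibniz_lie, ha, hb]
    simp

/-- The Killing form is invariant under a Lie algebra endomorphism of finite order. -/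
theorem killingForm_apply_of_pow_eq_one {K g : Type*} [Field K] [LieRing g] [LieAlgebra K g]
    {θ : Module.End K g} (hlie : ∀ x y : g, θ ⁅x, y⁆ = ⁅θ x, θ y⁆)
    {m : ℕ} (hm : 0 < m) (hθ : θ ^ m = 1) (x y : g) :
    killingForm K g (θ x) (θ y) = killingForm K g x y := by
  obtain ⟨k, rfl⟩ : ∃ k, m = k + 1 := ⟨m - 1, by omega⟩
  let e : g ≃ₗ⁅K⁆ g :=
    { θ with
      map_lie' := fun {x y} => hlie x y
      invFun := (θ ^ k : Module.End K g)
      left_inv := fun x => by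
        change (θ ^ k * θ) x = x
        rw [← pow_succ, hθ, Module.End.one_apply]
      right_inv := fun x => by
        change (θ * θ ^ k) x = x
        rw [← pow_succ', hθ, Module.End.one_apply] }
  exact LieAlgebra.killingForm_of_equiv_apply e x y

/-- If `X` is an eigenvector of a finite-order automorphism `θ` whose centralizer is a Cartan
subalgebra, then the Killing form pairs the `η`-eigenspace of `θ` on the centralizer of `X`
nondegenerately with the `η⁻¹`-eigenspace. -/
theorem exists_mem_eigenspace_inv_killingForm_ne_zero {K g : Type*} [Field K] [CharZero K]
    [LieRing g] [LieAlgebra K g] [Module.Finite K g] [LieAlgebra.IsKilling K g]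
    {θ : Module.End K g} (hlie : ∀ x y : g, θ ⁅x, y⁆ = ⁅θ x, θ y⁆)
    {m : ℕ} (hm : 0 < m) (hθ : θ ^ m = 1)
    {X : g} {ζ : K} (hζ : ζ ≠ 0) (hX : X ∈ Module.End.eigenspace θ ζ)
    (hCartan : (centralizerSubalgebra K g X).IsCartanSubalgebra)
    {η : K} (hη : η ^ m = 1) {x : g} (hx : x ∈ Module.End.eigenspace θ η)
    (hXx : ⁅X, x⁆ = 0) (hx0 : x ≠ 0) :
    ∃ y ∈ Module.End.eigenspace θ η⁻¹, ⁅X, y⁆ = 0 ∧ killingForm K g x y ≠ 0 := by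
  have hη0 : η ≠ 0 := by
    rintro rfl
    simp [hm.ne'] at hη
  rw [Module.End.mem_eigenspace_iff] at hX hx
  obtain ⟨y, hXy, hxy⟩ : ∃ y, ⁅X, y⁆ = 0 ∧ killingForm K g x y ≠ 0 := by
    by_contra! h
    have hker := LieAlgebra.IsKilling.ker_restrict_eq_bot_of_isCartanSubalgebra K g
      (centralizerSubalgebra K g X)
    have hmem : (⟨x, hXx⟩ : centralizerSubalgebra K g X) ∈
        LinearMap.ker ((killingForm K g).restrict (centralizerSubalgebra K g X)) := by
      rw [LinearMap.mem_ker]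
      ext y
      exact h y y.2
    rw [hker, Submodule.mem_bot] at hmem
    exact hx0 (congrArg Subtype.val hmem)
  have hpow (k : ℕ) : ⁅X, (θ ^ k) y⁆ = 0 ∧
      killingForm K g x (η ^ k • (θ ^ k) y) = killingForm K g x y := by
    induction k with
    | zero => simpa using hXy
    | succ k ih =>
      rw [pow_succ' θ, Module.End.mul_apply]
      constructor
      · have h := hlie X ((θ ^ k) y)
        rw [ih.1, map_zero, hX, smul_lie] at h
        exact (smul_eq_zero.mp h.symm).resolve_left hζ
      · rw [← ih.2, ← killingForm_apply_of_pow_eq_one hlie hm hθ x (η ^ k • (θ ^ k) y), hx]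
        simp [pow_succ, mul_assoc, mul_comm, mul_left_comm]
  refine ⟨∑ k ∈ Finset.range m, η ^ k • (θ ^ k) y, ?_, ?_, ?_⟩
  · rw [Module.End.mem_eigenspace_iff, eq_inv_smul_iff₀ hη0, map_sum, Finset.smul_sum]
    have hshift (k : ℕ) :
        η • θ (η ^ k • (θ ^ k) y) = η ^ (k + 1) • (θ ^ (k + 1)) y := by
      rw [map_smul, smul_smul, pow_succ' η, pow_succ' θ, Module.End.mul_apply]
    simp_rw [hshift]
    have h := Finset.sum_range_succ' (fun k => η ^ k • (θ ^ k) y) m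
    rw [Finset.sum_range_succ] at h
    simpa [hη, hθ] using h.symm
  · rw [lie_sum]
    exact Finset.sum_eq_zero fun k _ => by rw [lie_smul, (hpow k).1, smul_zero]
  · rw [map_sum, Finset.sum_congr rfl fun k _ => (hpow k).2]
    simpa [hm.ne'] using hxy

/-- Tensoring with a monomial is injective. -/
theorem T_tmul_eq_zero_iff {K M : Type*} [Field K] [AddCommGroup M] [Module K M]
    (n : ℤ) (x : M) : (T n : LaurentPolynomial K) ⊗ₜ[K] x = 0 ↔ x = 0 := by
  refine ⟨fun h => ?_, fun h => by rw [h, tmul_zero]⟩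
  have h' := congrArg ((T (-n) : LaurentPolynomial K) • ·) h
  simp only [smul_tmul', smul_eq_mul, smul_zero] at h'
  rwa [← T_add, neg_add_cancel, T_zero, Module.FaithfullyFlat.one_tmul_eq_zero_iff] at h'

/-- With `g(θ,m) ⊆ L = ℂ[u,u⁻¹] ⊗ g`, `p = u ⊗ X` for a regular
semisimple `X ∈ g₁`, `a` the centralizer of `p` in `g(θ,m)` with graded pieces
`aᵢ = a ⊓ (uⁱ ⊗ g_{i mod m})`, and the cocycle `c(v,w) = ⟨δ(v), w⟩` where `δ` is the
derivation `δ(uⁱ⊗x) = i·uⁱ⊗x`: for every `n ≠ 0` and every nonzero `z ∈ aₙ` there is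
`z' ∈ a₋ₙ` with `c(z, z') ≠ 0` (so the central extension of `a` defined by the
cocycle `c` is non-split). -/
theorem loop_centralizer_cocycle_nonvanishing
    (g : Type*) [LieRing g] [LieAlgebra ℂ g] [Module.Finite ℂ g]
    [LieAlgebra.IsSemisimple ℂ g]
    (m : ℕ) (hm : 0 < m)
    (ξ : ℂ) (hξ : ξ = Complex.exp (2 * Real.pi * Complex.I / m))
    (θ : Module.End ℂ g) (hθlie : ∀ x y : g, θ ⁅x, y⁆ = ⁅θ x, θ y⁆)
    (hθm : θ ^ m = 1)
    (gi : ℤ → Submodule ℂ g)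
    (hgi : ∀ i : ℤ, gi i = Module.End.eigenspace θ (ξ ^ i))
    (B : (LaurentPolynomial ℂ ⊗[ℂ] g) →ₗ[ℂ] (LaurentPolynomial ℂ ⊗[ℂ] g) →ₗ[ℂ] ℂ)
    (hB : ∀ (i j : ℤ) (x y : g),
      B (T i ⊗ₜ[ℂ] x) (T j ⊗ₜ[ℂ] y) = if i + j = 0 then killingForm ℂ g x y else 0)
    (δ : (LaurentPolynomial ℂ ⊗[ℂ] g) →ₗ[ℂ] (LaurentPolynomial ℂ ⊗[ℂ] g))
    (hδ : ∀ (i : ℤ) (x : g), δ (T i ⊗ₜ[ℂ] x) = (i : ℂ) • (T i ⊗ₜ[ℂ] x))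
    (piece : ℤ → Submodule ℂ (LaurentPolynomial ℂ ⊗[ℂ] g))
    (hpiece : ∀ n : ℤ,
      piece n = (gi n).map (TensorProduct.mk ℂ (LaurentPolynomial ℂ) g (T n)))
    (gθ : Submodule ℂ (LaurentPolynomial ℂ ⊗[ℂ] g)) (hgθ : gθ = ⨆ n : ℤ, piece n)
    (X : g) (hX : X ∈ gi 1)
    (hss : (LieAlgebra.ad ℂ g X).IsSemisimple)
    (hCartan : (centralizerSubalgebra ℂ g X).IsCartanSubalgebra)
    (p : LaurentPolynomial ℂ ⊗[ℂ] g) (hp : p = T 1 ⊗ₜ[ℂ] X)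
    (a : Submodule ℂ (LaurentPolynomial ℂ ⊗[ℂ] g))
    (ha : a = gθ ⊓ LinearMap.ker (LieAlgebra.ad ℂ (LaurentPolynomial ℂ ⊗[ℂ] g) p)) :
    ∀ n : ℤ, n ≠ 0 → ∀ z ∈ a ⊓ piece n, z ≠ 0 →
      ∃ z' ∈ a ⊓ piece (-n), B (δ z) z' ≠ 0 := by
  intro n hn z hz hz0
  have hξ0 : ξ ≠ 0 := hξ ▸ Complex.exp_ne_zero _
  have hξm : ξ ^ m = 1 := hξ ▸ (Complex.isPrimitiveRoot_exp m hm.ne').pow_eq_one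
  have hlie (k : ℤ) (x : g) : ⁅p, (T k : LaurentPolynomial ℂ) ⊗ₜ[ℂ] x⁆ = T (1 + k) ⊗ₜ[ℂ] ⁅X, x⁆ := by
    rw [hp, LieAlgebra.ExtendScalars.bracket_tmul, T_add]
  obtain ⟨hza, hzn⟩ := hz
  rw [hpiece] at hzn
  obtain ⟨x, hx, rfl⟩ := hzn
  rw [TensorProduct.mk_apply] at hza hz0 ⊢
  have hXx : ⁅X, x⁆ = 0 := by
    rw [ha] at hza
    have h : ⁅p, (T n : LaurentPolynomial ℂ) ⊗ₜ[ℂ] x⁆ = 0 := hza.2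
    rwa [hlie, T_tmul_eq_zero_iff] at h
  have hx0 : x ≠ 0 := fun h => hz0 (by rw [h, tmul_zero])
  rw [hgi] at hx hX
  rw [zpow_one] at hX
  have hη : (ξ ^ n) ^ m = 1 := by
    rw [← zpow_natCast, ← zpow_mul, mul_comm, zpow_mul, zpow_natCast, hξm, one_zpow]
  obtain ⟨y, hy, hXy, hxy⟩ := exists_mem_eigenspace_inv_killingForm_ne_zero hθlie hm hθm hξ0 hX
    hCartan hη hx hXx hx0
  have hyn : (T (-n) : LaurentPolynomial ℂ) ⊗ₜ[ℂ] y ∈ piece (-n) := by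
    rw [hpiece, hgi, zpow_neg]
    exact Submodule.mem_map_of_mem hy
  refine ⟨T (-n) ⊗ₜ[ℂ] y, ⟨?_, hyn⟩, ?_⟩
  · rw [ha, hgθ]
    refine ⟨Submodule.mem_iSup_of_mem (-n) hyn, ?_⟩
    change ⁅p, (T (-n) : LaurentPolynomial ℂ) ⊗ₜ[ℂ] y⁆ = 0
    rw [hlie, hXy, tmul_zero]
  · rw [hδ, map_smul, LinearMap.smul_apply, hB, if_pos (add_neg_cancel n), smul_eq_mul]
    exact mul_ne_zero (Int.cast_ne_zero.mpr hn) hxy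
end

section
/- Let g be a finite-dimensional semisimple Lie algebra over ℂ, let θ be a Lie algebra automorphism of g with θ^m = id, ξ_m = exp(2πi/m), and let g_i denote the ξ_m^i-eigenspace of θ. Let X ∈ g_1 be regular semisimple, i.e. ad X is semisimple and s := ker(ad X) is a Cartan subalgebra of g. In the loop algebra L := ℂ[u,u⁻¹] ⊗_ℂ g, let g(θ,m) := ⊕_{i∈ℤ} u^i ⊗ g_{i mod m} and p := u⊗X. Then the centralizer of p in g(θ,m) equals ⊕_{i∈ℤ} u^i ⊗ (s ∩ g_{i mod m}); in particular, it is a graded abelian Lie subalgebra whose i-th graded component is isomorphic to s ∩ g_{i mod m}. -/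
open TensorProduct LaurentPolynomial

/-- The identification of `ℂ[T,T⁻¹] ⊗ V` with finitely supported families of coefficients in `V`. -/
noncomputable def loopCoeff (V : Type*) [AddCommGroup V] [Module ℂ V] :
    LaurentPolynomial ℂ ⊗[ℂ] V ≃ₗ[ℂ] (ℤ →₀ V) :=
  TensorProduct.congr (AddMonoidAlgebra.coeffLinearEquiv ℂ) (LinearEquiv.refl ℂ V) ≪≫ₗ
    TensorProduct.finsuppScalarLeft ℂ V ℤ

section Coefficients

variable {V : Type*} [AddCommGroup V] [Module ℂ V]

lemma loopCoeff_tmul_apply (f : LaurentPolynomial ℂ) (x : V) (k : ℤ) :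
    loopCoeff V (f ⊗ₜ x) k = f.coeff k • x := by
  simp [loopCoeff, TensorProduct.finsuppScalarLeft_apply_tmul_apply]

lemma loopCoeff_T_tmul (n : ℤ) (x : V) :
    loopCoeff V (T n ⊗ₜ x) = Finsupp.single n x := by
  ext k
  rw [loopCoeff_tmul_apply, T_apply, Finsupp.single_apply]
  split_ifs <;> simp

lemma eq_sum_T_tmul_loopCoeff (v : LaurentPolynomial ℂ ⊗[ℂ] V) :
    v = (loopCoeff V v).sum fun n x => T n ⊗ₜ[ℂ] x := by
  apply (loopCoeff V).injective
  rw [map_finsuppSum]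
  simp only [loopCoeff_T_tmul]
  exact (Finsupp.sum_single _).symm

lemma mem_iSup_map_mk_T_iff (P : ℤ → Submodule ℂ V) (v : LaurentPolynomial ℂ ⊗[ℂ] V) :
    v ∈ ⨆ n, (P n).map (TensorProduct.mk ℂ (LaurentPolynomial ℂ) V (T n)) ↔
      ∀ k, loopCoeff V v k ∈ P k := by
  constructor
  · intro hv k
    suffices h : ⨆ n, (P n).map (TensorProduct.mk ℂ (LaurentPolynomial ℂ) V (T n)) ≤
        (P k).comap (Finsupp.lapply k ∘ₗ (loopCoeff V).toLinearMap) from h hv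
    refine iSup_le fun n => Submodule.map_le_iff_le_comap.mpr fun x hx => ?_
    simp only [Submodule.mem_comap, LinearMap.comp_apply, TensorProduct.mk_apply,
      LinearEquiv.coe_coe, loopCoeff_T_tmul, Finsupp.lapply_apply, Finsupp.single_apply]
    split_ifs with h
    · exact h ▸ hx
    · exact zero_mem _
  · intro h
    rw [eq_sum_T_tmul_loopCoeff v]
    exact sum_mem fun n _ => Submodule.mem_iSup_of_mem n (Submodule.mem_map_of_mem (h n))

end Coefficients

section LoopBracket

variable {g : Type*} [LieRing g] [LieAlgebra ℂ g]

lemma ad_tmul_tmul (f₁ f₂ : LaurentPolynomial ℂ) (x y : g) :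
    LieAlgebra.ad ℂ (LaurentPolynomial ℂ ⊗[ℂ] g) (f₁ ⊗ₜ x) (f₂ ⊗ₜ y) = (f₁ * f₂) ⊗ₜ ⁅x, y⁆ :=
  LieAlgebra.ExtendScalars.bracket_tmul ..

lemma loopCoeff_ad_T_tmul (n : ℤ) (X : g) (v : LaurentPolynomial ℂ ⊗[ℂ] g) (k : ℤ) :
    loopCoeff g (LieAlgebra.ad ℂ (LaurentPolynomial ℂ ⊗[ℂ] g) (T n ⊗ₜ X) v) (n + k) =
      ⁅X, loopCoeff g v k⁆ := by
  induction v with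
  | zero => simp only [map_zero, Finsupp.coe_zero, Pi.zero_apply, lie_zero]
  | add v w hv hw => simp only [map_add, Finsupp.add_apply, hv, hw, lie_add]
  | tmul f x =>
    rw [ad_tmul_tmul, loopCoeff_tmul_apply, loopCoeff_tmul_apply, lie_smul, T,
      AddMonoidAlgebra.coeff_single_mul_add, one_mul]

lemma ad_T_tmul_eq_zero_iff (n : ℤ) (X : g) (v : LaurentPolynomial ℂ ⊗[ℂ] g) :
    LieAlgebra.ad ℂ (LaurentPolynomial ℂ ⊗[ℂ] g) (T n ⊗ₜ X) v = 0 ↔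
      ∀ k, LieAlgebra.ad ℂ g X (loopCoeff g v k) = 0 := by
  simp only [LieAlgebra.ad_apply ℂ g, ← loopCoeff_ad_T_tmul n]
  constructor
  · intro h k
    rw [h, map_zero, Finsupp.coe_zero, Pi.zero_apply]
  · intro h
    apply (loopCoeff g).injective
    ext k
    simpa using h (k - n)

lemma lie_eq_zero_of_loopCoeff {v w : LaurentPolynomial ℂ ⊗[ℂ] g}
    (h : ∀ i j, ⁅loopCoeff g v i, loopCoeff g w j⁆ = 0) : ⁅v, w⁆ = 0 := by
  change LieAlgebra.ad ℂ (LaurentPolynomial ℂ ⊗[ℂ] g) v w = 0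
  rw [eq_sum_T_tmul_loopCoeff v, eq_sum_T_tmul_loopCoeff w]
  simp only [Finsupp.sum, map_sum, LinearMap.sum_apply, ad_tmul_tmul, h, TensorProduct.tmul_zero,
    Finset.sum_const_zero]

end LoopBracket

/-- For a torsion automorphism `θ` (with `θ^m = 1`) of a
finite-dimensional complex semisimple Lie algebra `g`, eigenspaces `gᵢ`, and a
regular semisimple `X ∈ g₁` with centralizer (Cartan subalgebra) `s = ker (ad X)`,
the centralizer of `p = u ⊗ X` in `g(θ,m) = ⊕ᵢ uⁱ ⊗ g_{i mod m}` equals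
`⊕ᵢ uⁱ ⊗ (s ⊓ gᵢ)`; in particular it is a graded abelian Lie subalgebra whose
`i`-th graded component is the image of `s ⊓ g_{i mod m}`. -/
theorem loop_centralizer_eq_graded_cartan_pieces
    (g : Type*) [LieRing g] [LieAlgebra ℂ g] [Module.Finite ℂ g]
    [LieAlgebra.IsSemisimple ℂ g]
    (m : ℕ) (hm : 0 < m)
    (ξ : ℂ) (hξ : ξ = Complex.exp (2 * Real.pi * Complex.I / m))
    (θ : Module.End ℂ g) (hθlie : ∀ x y : g, θ ⁅x, y⁆ = ⁅θ x, θ y⁆)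
    (hθm : θ ^ m = 1)
    (gi : ℤ → Submodule ℂ g)
    (hgi : ∀ i : ℤ, gi i = Module.End.eigenspace θ (ξ ^ i))
    (X : g) (hX : X ∈ gi 1)
    (hss : (LieAlgebra.ad ℂ g X).IsSemisimple)
    (s : Submodule ℂ g) (hs : s = LinearMap.ker (LieAlgebra.ad ℂ g X))
    (hCartan : (centralizerSubalgebra ℂ g X).IsCartanSubalgebra)
    (piece : ℤ → Submodule ℂ (LaurentPolynomial ℂ ⊗[ℂ] g))
    (hpiece : ∀ n : ℤ,
      piece n = (gi n).map (TensorProduct.mk ℂ (LaurentPolynomial ℂ) g (T n)))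
    (gθ : Submodule ℂ (LaurentPolynomial ℂ ⊗[ℂ] g)) (hgθ : gθ = ⨆ n : ℤ, piece n)
    (p : LaurentPolynomial ℂ ⊗[ℂ] g) (hp : p = T 1 ⊗ₜ[ℂ] X) :
    (gθ ⊓ LinearMap.ker (LieAlgebra.ad ℂ (LaurentPolynomial ℂ ⊗[ℂ] g) p) =
      ⨆ i : ℤ, Submodule.map (TensorProduct.mk ℂ (LaurentPolynomial ℂ) g (T i))
        (s ⊓ gi i)) ∧
    (∀ v ∈ gθ ⊓ LinearMap.ker (LieAlgebra.ad ℂ (LaurentPolynomial ℂ ⊗[ℂ] g) p),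
     ∀ w ∈ gθ ⊓ LinearMap.ker (LieAlgebra.ad ℂ (LaurentPolynomial ℂ ⊗[ℂ] g) p),
        ⁅v, w⁆ = 0) := by
  subst hs hgθ hp
  have key (v : LaurentPolynomial ℂ ⊗[ℂ] g) :
      v ∈ (⨆ n, piece n) ⊓
          LinearMap.ker (LieAlgebra.ad ℂ (LaurentPolynomial ℂ ⊗[ℂ] g) (T 1 ⊗ₜ[ℂ] X)) ↔
        ∀ k, loopCoeff g v k ∈ LinearMap.ker (LieAlgebra.ad ℂ g X) ⊓ gi k := by
    simp only [hpiece, Submodule.mem_inf, mem_iSup_map_mk_T_iff, LinearMap.mem_ker,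
      ad_T_tmul_eq_zero_iff, forall_and, and_comm]
  refine ⟨?_, fun v hv w hw => lie_eq_zero_of_loopCoeff fun i j => ?_⟩
  · ext v
    rw [key, mem_iSup_map_mk_T_iff]
  · have hvi : loopCoeff g v i ∈ centralizerSubalgebra ℂ g X := ((key v).mp hv i).1
    have hwj : loopCoeff g w j ∈ centralizerSubalgebra ℂ g X := ((key w).mp hw j).1
    have habel : IsLieAbelian (centralizerSubalgebra ℂ g X) :=
      LieAlgebra.IsKilling.instIsLieAbelianOfIsCartanSubalgebra ℂ g _
    exact congrArg Subtype.val (habel.trivial ⟨_, hvi⟩ ⟨_, hwj⟩)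
end
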